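/- Let h1, h2 and w be positive integers with 3w ≤ h2 ≤ C(h1+1,2). Let x be the smallest integer k such that 3w ≤ C(k+1,2), and let y = min{h2, C(x+1,2)}. If there exists a 2-dimensional connected Buchsbaum simplicial complex Δ with h(Δ) = (1,x,y,−w), then there exists a 2-dimensional connected Buchsbaum simplicial complex Γ with h(Γ) = (1,h1,h2,−w). -/

import Mathlib

open Finset

noncomputable section

/-- `Δ` is a simplicial complex on `[n] = {1,…,n}`: a collection of subsets of `[n]`,
closed under taking subsets, containing every singleton `{i}` for `i ∈ [n]`. -/
def IsComplexOn (n : ℕ) (Δ : Finset (Finset ℕ)) : Prop :=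
  (∀ F ∈ Δ, ∀ G ⊆ F, G ∈ Δ) ∧
  (∀ F ∈ Δ, ∀ i ∈ F, i ∈ Finset.Icc 1 n) ∧
  (∀ i ∈ Finset.Icc 1 n, ({i} : Finset ℕ) ∈ Δ)

/-- a simplicial complex whose vertex set is contained in `[n]`:
a downward closed collection of subsets of `[n]`. -/
def IsComplexIn (n : ℕ) (Δ : Finset (Finset ℕ)) : Prop :=
  (∀ F ∈ Δ, ∀ G ⊆ F, G ∈ Δ) ∧ (∀ F ∈ Δ, ∀ i ∈ F, i ∈ Finset.Icc 1 n)

/-- the faces of `Δ` with `m` vertices -/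
def facesOf (Δ : Finset (Finset ℕ)) (m : ℕ) : Finset (Finset ℕ) :=
  Δ.filter fun F => F.card = m

/-- `fVec Δ j = f_{j-1}(Δ)`, the number of faces of `Δ` with `j` vertices;
by convention `f_{-1}(Δ) = 1`. -/
def fVec (Δ : Finset (Finset ℕ)) (j : ℕ) : ℤ :=
  if j = 0 then 1 else ((facesOf Δ j).card : ℤ)

/-- the `h`-vector of a `(d-1)`-dimensional complex, defined by
`∑ f_{i-1} (x-1)^{d-i} = ∑ h_i x^{d-i}`, i.e.
`h_i = ∑_{j=0}^{i} (-1)^{i-j} C(d-j, i-j) f_{j-1}`. -/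
def hVec (d : ℕ) (Δ : Finset (Finset ℕ)) (i : ℕ) : ℤ :=
  ∑ j ∈ Finset.range (i + 1),
    (-1 : ℤ) ^ (i - j) * ((d - j).choose (i - j) : ℤ) * fVec Δ j

/-- the dimension `max {k : f_k(Δ) ≠ 0}` of `Δ`, as an integer -/
def dimZ (Δ : Finset (Finset ℕ)) : ℤ := ((Δ.sup Finset.card : ℕ) : ℤ) - 1

/-- the link `lk_Δ(F) = {G : G ∩ F = ∅, G ∪ F ∈ Δ}` -/
def link (Δ : Finset (Finset ℕ)) (F : Finset ℕ) : Finset (Finset ℕ) :=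
  Δ.filter fun G => Disjoint G F ∧ G ∪ F ∈ Δ

variable (K : Type) [Field K]

/-- the simplicial boundary operator on formal `K`-linear combinations of
finite subsets of `ℕ` (vertices ordered by the order on `ℕ`):
`∂ F = ∑_{v ∈ F} (-1)^{#{u ∈ F : u < v}} (F \ {v})`. -/
def bdry : (Finset ℕ →₀ K) →ₗ[K] (Finset ℕ →₀ K) :=
  Finsupp.lsum K fun F => LinearMap.toSpanSingleton K (Finset ℕ →₀ K)
    (∑ v ∈ F, ((-1 : K) ^ ((F.filter fun u => u < v).card)) • Finsupp.single (F.erase v) (1 : K))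

/-- the space of simplicial `K`-chains of `Δ` spanned by the faces with `m` vertices
(for `m = 0` this is the span of the empty face, giving *reduced* homology) -/
def chains (Δ : Finset (Finset ℕ)) (m : ℕ) : Submodule K (Finset ℕ →₀ K) :=
  Submodule.span K ((fun F => Finsupp.single F (1 : K)) '' (facesOf Δ m : Set (Finset ℕ)))

/-- the dimension of the reduced homology of `Δ` at faces of cardinality `m`:
`dim (ker ∂ ∩ C_m) - dim (∂ C_{m+1})` -/
def homDim (Δ : Finset (Finset ℕ)) (m : ℕ) : ℕ :=
  Module.finrank K ↥(chains K Δ m ⊓ LinearMap.ker (bdry K))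
    - Module.finrank K ↥((chains K Δ (m + 1)).map (bdry K))

/-- the reduced Betti number `β_i(Δ; K) = dim_K H̃_i(Δ; K)` for `i : ℤ` -/
def betti (Δ : Finset (Finset ℕ)) (i : ℤ) : ℕ :=
  if 0 ≤ i + 1 then homDim K Δ (i + 1).toNat else 0

/-- all facets (maximal faces) of `Δ` have the same cardinality -/
def IsPure (Δ : Finset (Finset ℕ)) : Prop :=
  ∀ F ∈ Δ, (∀ G ∈ Δ, F ⊆ G → F = G) → F.card = Δ.sup Finset.card

/-- `Δ` is Cohen–Macaulay (over `K`): for every face `F ∈ Δ` (including `∅`),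
`β_i(lk_Δ(F)) = 0` for all `i ≠ dim Δ - |F|`. -/
def IsCohenMacaulay (Δ : Finset (Finset ℕ)) : Prop :=
  ∀ F ∈ Δ, ∀ i : ℤ, i ≠ dimZ Δ - F.card → betti K (link Δ F) i = 0

/-- `Δ` is Buchsbaum (over `K`): `Δ` is pure and the link of every vertex is
Cohen–Macaulay. -/
def IsBuchsbaum (Δ : Finset (Finset ℕ)) : Prop :=
  IsPure Δ ∧ ∀ v : ℕ, ({v} : Finset ℕ) ∈ Δ → IsCohenMacaulay K (link Δ {v})

/-- `Δ` is connected: any two vertices are joined by a path of edges of `Δ` -/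
def IsConnectedComplex (Δ : Finset (Finset ℕ)) : Prop :=
  ∀ u v : ℕ, ({u} : Finset ℕ) ∈ Δ → ({v} : Finset ℕ) ∈ Δ →
    Relation.ReflTransGen (fun a b : ℕ => a ≠ b ∧ ({a, b} : Finset ℕ) ∈ Δ) u v

/-- `Δ` is link-acyclic: `β_i(lk_Δ(v)) = 0` for every vertex `v` of `Δ` and every `i` -/
def IsLinkAcyclic (Δ : Finset (Finset ℕ)) : Prop :=
  ∀ v : ℕ, ({v} : Finset ℕ) ∈ Δ → ∀ i : ℤ, betti K (link Δ {v}) i = 0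

/-- `Δ` is `2`-dimensional with `h`-vector `(a, b, c, e)` -/
def hVector3 (Δ : Finset (Finset ℕ)) (a b c e : ℤ) : Prop :=
  hVec 3 Δ 0 = a ∧ hVec 3 Δ 1 = b ∧ hVec 3 Δ 2 = c ∧ hVec 3 Δ 3 = e

/-- `macaulay2 a = a^⟨2⟩`: if `a = C(b,2) + r` is the (greedy) `2`-nd Macaulay
representation (`b` maximal with `C(b,2) ≤ a`, `0 ≤ r < b`, `r = C(r,1)`), then
`a^⟨2⟩ = C(b+1,3) + C(r+1,2)`, and `0^⟨2⟩ = 0`. -/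
def macaulay2 (a : ℕ) : ℕ :=
  if a = 0 then 0
  else
    (Nat.findGreatest (fun t => t.choose 2 ≤ a) (a + 2) + 1).choose 3
      + (a - (Nat.findGreatest (fun t => t.choose 2 ≤ a) (a + 2)).choose 2 + 1).choose 2

/-- `modRep n i = ī`, the unique element of `[n] = {1,…,n}` congruent to `i` mod `n` -/
def modRep (n : ℕ) (i : ℤ) : ℕ := ((i - 1) % (n : ℤ)).toNat + 1


end

section Homology

variable {K : Type} [Field K]

lemma bdry_single (F : Finset ℕ) :
    bdry K (Finsupp.single F 1) =
      ∑ v ∈ F, ((-1 : K) ^ ((F.filter fun u => u < v).card)) • Finsupp.single (F.erase v) (1 : K) := by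
  simp [bdry]

lemma bdry_single_singleton (a : ℕ) :
    bdry K (Finsupp.single {a} 1) = Finsupp.single ∅ 1 := by
  rw [bdry_single]
  simp [Finset.filter_singleton]

lemma bdry_single_pair {a b : ℕ} (h : a < b) :
    bdry K (Finsupp.single {a, b} 1) = Finsupp.single {b} 1 - Finsupp.single {a} 1 := by
  have e1 : ({a, b} : Finset ℕ).erase a = {b} := by
    ext x; simp only [mem_erase, mem_insert, mem_singleton]; omega
  have e2 : ({a, b} : Finset ℕ).erase b = {a} := by
    ext x; simp only [mem_erase, mem_insert, mem_singleton]; omega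
  have e3 : ({a, b} : Finset ℕ).filter (fun u => u < a) = ∅ := by
    ext x; simp only [mem_filter, mem_insert, mem_singleton, notMem_empty, iff_false]; omega
  have e4 : ({a, b} : Finset ℕ).filter (fun u => u < b) = {a} := by
    ext x; simp only [mem_filter, mem_insert, mem_singleton]; omega
  rw [bdry_single, Finset.sum_pair h.ne, e1, e2, e3, e4]
  simp [sub_eq_add_neg]

lemma single_mem_chains {L : Finset (Finset ℕ)} {F : Finset ℕ} (hF : F ∈ L) :
    Finsupp.single F (1 : K) ∈ chains K L F.card :=
  Submodule.subset_span ⟨F, by simp [facesOf, hF], rfl⟩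

lemma chains_mono {L M : Finset (Finset ℕ)} (h : L ⊆ M) (m : ℕ) : chains K L m ≤ chains K M m := by
  apply Submodule.span_mono
  apply Set.image_mono
  intro F hF
  simp only [facesOf, coe_filter, Set.mem_ofPred_eq] at hF ⊢
  exact ⟨h hF.1, hF.2⟩

instance finiteDimensional_chains (L : Finset (Finset ℕ)) (m : ℕ) :
    FiniteDimensional K (chains K L m) :=
  FiniteDimensional.span_of_finite K ((facesOf L m).finite_toSet.image _)

lemma homDim_eq_zero_of_le {L : Finset (Finset ℕ)} {m : ℕ}
    (h : chains K L m ⊓ LinearMap.ker (bdry K) ≤ (chains K L (m + 1)).map (bdry K)) :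
    homDim K L m = 0 :=
  Nat.sub_eq_zero_of_le (Submodule.finrank_mono h)

lemma homDim_eq_zero_of_card_lt {L : Finset (Finset ℕ)} {m : ℕ} (h : ∀ F ∈ L, F.card < m) :
    homDim K L m = 0 := by
  apply homDim_eq_zero_of_le
  have : facesOf L m = ∅ := by
    rw [facesOf, Finset.filter_eq_empty_iff]
    intro F hF
    exact (h F hF).ne
  have h0 : chains K L m = ⊥ := by simp [chains, this]
  rw [h0, bot_inf_eq]
  exact bot_le

lemma homDim_zero_eq_zero {L : Finset (Finset ℕ)} {a : ℕ} (ha : {a} ∈ L) : homDim K L 0 = 0 := by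
  apply homDim_eq_zero_of_le
  refine inf_le_left.trans (Submodule.span_le.2 ?_)
  rintro _ ⟨F, hF, rfl⟩
  simp only [facesOf, coe_filter, Set.mem_ofPred_eq, card_eq_zero] at hF
  obtain ⟨-, rfl⟩ := hF
  have := single_mem_chains (K := K) ha
  rw [card_singleton] at this
  exact ⟨_, this, bdry_single_singleton a⟩

variable (K) in
/-- the vertices `a` and `b` are homologous in the complex `L` -/
def Homologous (L : Finset (Finset ℕ)) (a b : ℕ) : Prop :=
  Finsupp.single {a} 1 - Finsupp.single {b} 1 ∈ (chains K L 2).map (bdry K)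

lemma Homologous.refl (L : Finset (Finset ℕ)) (a : ℕ) : Homologous K L a a := by
  simp [Homologous]

lemma Homologous.symm {L : Finset (Finset ℕ)} {a b : ℕ} (h : Homologous K L a b) :
    Homologous K L b a := by
  have := Submodule.neg_mem _ h
  rwa [neg_sub] at this

lemma Homologous.trans {L : Finset (Finset ℕ)} {a b c : ℕ} (h : Homologous K L a b)
    (h' : Homologous K L b c) : Homologous K L a c := by
  have := Submodule.add_mem _ h h'
  rwa [sub_add_sub_cancel] at this

lemma Homologous.mono {L M : Finset (Finset ℕ)} (hLM : L ⊆ M) {a b : ℕ} (h : Homologous K L a b) :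
    Homologous K M a b :=
  Submodule.map_mono (chains_mono hLM 2) h

lemma Homologous.of_edge {L : Finset (Finset ℕ)} {a b : ℕ} (hab : a ≠ b) (h : {a, b} ∈ L) :
    Homologous K L a b := by
  have key : ∀ {a b : ℕ}, a < b → {a, b} ∈ L → Homologous K L b a := fun {a b} hab h => by
    refine ⟨_, ?_, bdry_single_pair hab⟩
    have := single_mem_chains (K := K) h
    rwa [Finset.card_pair hab.ne] at this
  rcases hab.lt_or_gt with hlt | hlt
  · exact (key hlt h).symm
  · exact key hlt (by rwa [Finset.pair_comm])

variable (K) in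
/-- any two vertices of `L` are homologous -/
def IsHomConnected (L : Finset (Finset ℕ)) : Prop :=
  ∀ a b : ℕ, {a} ∈ L → {b} ∈ L → Homologous K L a b

lemma homDim_one_eq_zero {L : Finset (Finset ℕ)} (hL : IsHomConnected K L) :
    homDim K L 1 = 0 := by
  apply homDim_eq_zero_of_le
  rintro c ⟨hc, hk⟩
  by_cases hne : ∃ a : ℕ, ({a} : Finset ℕ) ∈ L
  · obtain ⟨a, ha⟩ := hne
    have key : ∀ c ∈ chains K L 1,
        c - (bdry K c ∅) • Finsupp.single {a} (1 : K) ∈ (chains K L 2).map (bdry K) := by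
      intro c hc
      induction hc using Submodule.span_induction with
      | mem c hc =>
        obtain ⟨F, hF, rfl⟩ := hc
        simp only [facesOf, coe_filter, Set.mem_ofPred_eq, card_eq_one] at hF
        obtain ⟨hF, b, rfl⟩ := hF
        simpa [bdry_single_singleton, Homologous] using hL b a hF ha
      | zero => simp
      | add c d _ _ hc hd =>
        have := Submodule.add_mem _ hc hd
        rw [map_add, Finsupp.add_apply, add_smul]
        convert this using 1
        abel
      | smul r c _ hc =>
        have := Submodule.smul_mem _ r hc
        rw [map_smul, Finsupp.smul_apply, smul_assoc, ← smul_sub]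
        exact this
    have := key c hc
    rw [LinearMap.mem_ker.1 hk] at this
    simpa using this
  · have h0 : facesOf L 1 = ∅ := by
      rw [facesOf, Finset.filter_eq_empty_iff]
      intro F hF h1
      obtain ⟨a, rfl⟩ := card_eq_one.1 h1
      exact hne ⟨a, hF⟩
    have h1 : c = 0 := by simpa [chains, h0] using hc
    rw [h1]
    exact Submodule.zero_mem _

lemma isHomConnected_of_homDim_one {L : Finset (Finset ℕ)} (hL : ∀ F ∈ L, ∀ G ⊆ F, G ∈ L)
    (h : homDim K L 1 = 0) : IsHomConnected K L := by
  have hle : (chains K L 2).map (bdry K) ≤ chains K L 1 ⊓ LinearMap.ker (bdry K) := by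
    rw [Submodule.map_le_iff_le_comap, chains, Submodule.span_le]
    rintro _ ⟨F, hF, rfl⟩
    simp only [facesOf, coe_filter, Set.mem_ofPred_eq, card_eq_two] at hF
    obtain ⟨hF, a, b, hab, rfl⟩ := hF
    have key : ∀ {a b : ℕ}, a < b → {a, b} ∈ L →
        bdry K (Finsupp.single {a, b} 1) ∈ chains K L 1 ⊓ LinearMap.ker (bdry K) := by
      intro a b hab hF
      rw [bdry_single_pair hab]
      refine ⟨Submodule.sub_mem _ ?_ ?_, ?_⟩
      · exact single_mem_chains (F := {b}) (hL _ hF _ (by simp))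
      · exact single_mem_chains (F := {a}) (hL _ hF _ (by simp))
      · simp [bdry_single_singleton]
    rcases hab.lt_or_gt with hlt | hlt
    · exact key hlt hF
    · rw [Finset.pair_comm] at hF ⊢
      exact key hlt hF
  have heq := Submodule.eq_of_le_of_finrank_le hle (Nat.le_of_sub_eq_zero h)
  intro a b ha hb
  rw [Homologous, heq]
  refine ⟨Submodule.sub_mem _ ?_ ?_, ?_⟩
  · exact single_mem_chains (F := {a}) ha
  · exact single_mem_chains (F := {b}) hb
  · simp [bdry_single_singleton]

/-- `L` is nonempty, downward closed, and all its facets have `m` vertices. -/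
structure IsPureComplex (m : ℕ) (L : Finset (Finset ℕ)) : Prop where
  nonempty : L.Nonempty
  down : ∀ F ∈ L, ∀ G ⊆ F, G ∈ L
  exists_facet : ∀ F ∈ L, ∃ G ∈ L, F ⊆ G ∧ G.card = m
  card_le : ∀ F ∈ L, F.card ≤ m

lemma mem_link {Δ : Finset (Finset ℕ)} (hΔ : ∀ F ∈ Δ, ∀ G ⊆ F, G ∈ Δ) {F G : Finset ℕ} :
    G ∈ link Δ F ↔ Disjoint G F ∧ G ∪ F ∈ Δ := by
  simp only [link, mem_filter, and_iff_right_iff_imp]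
  exact fun h => hΔ _ h.2 _ subset_union_left

lemma IsPureComplex.sup_card {m : ℕ} {L : Finset (Finset ℕ)} (h : IsPureComplex m L) :
    L.sup Finset.card = m := by
  apply le_antisymm (Finset.sup_le h.card_le)
  obtain ⟨F, hF⟩ := h.nonempty
  obtain ⟨G, hG, -, rfl⟩ := h.exists_facet F hF
  exact Finset.le_sup hG

lemma IsPureComplex.link {m k : ℕ} {L : Finset (Finset ℕ)} (h : IsPureComplex (m + k) L)
    {F : Finset ℕ} (hF : F ∈ L) (hk : F.card = k) : IsPureComplex m (link L F) where
  nonempty := ⟨∅, (mem_link h.down).2 (by simpa using hF)⟩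
  down G hG H hH := by
    rw [mem_link h.down] at hG ⊢
    exact ⟨hG.1.mono_left hH, h.down _ hG.2 _ (union_subset_union_left hH)⟩
  exists_facet G hG := by
    rw [mem_link h.down] at hG
    obtain ⟨H, hH, hGH, hc⟩ := h.exists_facet _ hG.2
    have hFH : F ⊆ H := subset_union_right.trans hGH
    refine ⟨H \ F, (mem_link h.down).2 ⟨sdiff_disjoint, ?_⟩, ?_, ?_⟩
    · rwa [sdiff_union_of_subset hFH]
    · exact subset_sdiff.2 ⟨subset_union_left.trans hGH, hG.1⟩
    · rw [card_sdiff_of_subset hFH]; omega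
  card_le G hG := by
    rw [mem_link h.down] at hG
    have := h.card_le _ hG.2
    rw [card_union_of_disjoint hG.1] at this
    omega

lemma link_empty (L : Finset (Finset ℕ)) : link L ∅ = L := by
  simp [link]

lemma isCohenMacaulay_iff {L : Finset (Finset ℕ)} (h : IsPureComplex 2 L) :
    IsCohenMacaulay K L ↔ IsHomConnected K L := by
  have h0 : (∅ : Finset ℕ) ∈ L := by
    obtain ⟨F, hF⟩ := h.nonempty
    exact h.down F hF _ (empty_subset _)
  have hd : dimZ L = 1 := by simp [dimZ, h.sup_card]
  constructor
  · intro hcm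
    have := hcm ∅ h0 0 (by simp [hd])
    rw [link_empty] at this
    exact isHomConnected_of_homDim_one h.down (by simpa [betti] using this)
  · intro hc F hF i hi
    rw [hd] at hi
    rw [betti]
    split_ifs with hi0
    swap
    · rfl
    obtain ⟨m, hm⟩ := Int.eq_ofNat_of_zero_le hi0
    rw [hm, Int.toNat_natCast]
    have hF2 := h.card_le F hF
    obtain ⟨k, hk⟩ : ∃ k, k + F.card = 2 := ⟨2 - F.card, by omega⟩
    have hM := IsPureComplex.link (m := k) (by rwa [hk]) hF rfl
    rcases lt_trichotomy m k with hlt | heq | hgt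
    · obtain rfl | rfl : m = 0 ∨ m = 1 := by omega
      · obtain ⟨G, hG⟩ := hM.nonempty
        obtain ⟨H, hH, -, hc⟩ := hM.exists_facet G hG
        obtain ⟨a, ha⟩ : H.Nonempty := by rw [← card_pos]; omega
        exact homDim_zero_eq_zero (hM.down _ hH {a} (by simpa using ha))
      · obtain rfl : F = ∅ := by rw [← card_eq_zero]; omega
        rw [link_empty]
        exact homDim_one_eq_zero hc
    · omega
    · exact homDim_eq_zero_of_card_lt fun G hG => (hM.card_le G hG).trans_lt hgt

lemma isPureComplex_three {Δ : Finset (Finset ℕ)} (hdown : ∀ F ∈ Δ, ∀ G ⊆ F, G ∈ Δ)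
    (hd : dimZ Δ = 2) (hp : IsPure Δ) : IsPureComplex 3 Δ := by
  have hs : Δ.sup Finset.card = 3 := by rw [dimZ] at hd; omega
  refine ⟨?_, hdown, fun F hF => ?_, fun F hF => hs ▸ Finset.le_sup (f := Finset.card) hF⟩
  · rw [Finset.nonempty_iff_ne_empty]
    rintro rfl
    simp at hs
  · obtain ⟨G, hFG, hG⟩ := Δ.exists_le_maximal hF
    refine ⟨G, hG.1, hFG, ?_⟩
    rw [← hs]
    exact hp G hG.1 fun H hH hGH => subset_antisymm hGH (hG.2 hH hGH)

lemma IsPureComplex.isPure {m : ℕ} {Δ : Finset (Finset ℕ)} (h : IsPureComplex m Δ) :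
    IsPure Δ := by
  intro F hF hmax
  obtain ⟨G, hG, hFG, hc⟩ := h.exists_facet F hF
  rw [hmax G hG hFG, hc, h.sup_card]

lemma isBuchsbaum_iff {Δ : Finset (Finset ℕ)} (h : IsPureComplex 3 Δ) :
    IsBuchsbaum K Δ ↔ ∀ v : ℕ, {v} ∈ Δ → IsHomConnected K (link Δ {v}) := by
  have key : ∀ v : ℕ, {v} ∈ Δ →
      (IsCohenMacaulay K (link Δ {v}) ↔ IsHomConnected K (link Δ {v})) := fun v hv =>
    isCohenMacaulay_iff (IsPureComplex.link (m := 2) (k := 1) h hv (card_singleton v))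
  exact ⟨fun hb v hv => (key v hv).1 (hb.2 v hv),
    fun hb => ⟨h.isPure, fun v hv => (key v hv).2 (hb v hv)⟩⟩

end Homology

section AddTriangle

variable {K : Type} [Field K] {n : ℕ} {Δ : Finset (Finset ℕ)} {t : Finset ℕ}

lemma IsPureComplex.union_powerset {m : ℕ} (h : IsPureComplex m Δ) (ht : t.card = m) :
    IsPureComplex m (Δ ∪ t.powerset) where
  nonempty := h.nonempty.mono subset_union_left
  down F hF G hG := by
    simp only [mem_union, mem_powerset] at hF ⊢
    exact hF.imp (fun hF => h.down F hF G hG) fun hF => hG.trans hF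
  exists_facet F hF := by
    simp only [mem_union, mem_powerset] at hF
    rcases hF with hF | hF
    · obtain ⟨G, hG, hFG⟩ := h.exists_facet F hF
      exact ⟨G, mem_union_left _ hG, hFG⟩
    · exact ⟨t, by simp, hF, ht⟩
  card_le F hF := by
    simp only [mem_union, mem_powerset] at hF
    exact hF.elim (h.card_le F) fun hF => ht ▸ card_le_card hF

lemma isHomConnected_of_base {L : Finset (Finset ℕ)} (p : ℕ)
    (h : ∀ a, {a} ∈ L → Homologous K L a p) : IsHomConnected K L :=
  fun a b ha hb => (h a ha).trans (h b hb).symm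

lemma singleton_mem_link (hΔ : ∀ F ∈ Δ, ∀ G ⊆ F, G ∈ Δ) {a u : ℕ} :
    {a} ∈ link Δ {u} ↔ a ≠ u ∧ {a, u} ∈ Δ := by
  rw [mem_link hΔ, disjoint_singleton, singleton_union]

/-- Adding a triangle `t` keeps vertex links connected, provided each vertex of `t` is new
or is joined in `Δ` to another vertex of `t`. -/
lemma isHomConnected_link_union_powerset (h : IsPureComplex 3 Δ) (ht : t.card = 3)
    (hlink : ∀ v : ℕ, {v} ∈ Δ → IsHomConnected K (link Δ {v}))
    (hadj : ∀ u ∈ t, {u} ∉ Δ ∨ ∃ p ∈ t, p ≠ u ∧ {p, u} ∈ Δ) (u : ℕ) (hu : {u} ∈ Δ ∪ t.powerset) :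
    IsHomConnected K (link (Δ ∪ t.powerset) {u}) := by
  have hΓ := h.union_powerset ht
  have hsub : link Δ {u} ⊆ link (Δ ∪ t.powerset) {u} := by
    intro G hG
    rw [mem_link h.down] at hG
    rw [mem_link hΓ.down]
    exact ⟨hG.1, mem_union_left _ hG.2⟩
  by_cases hut : u ∈ t
  · have hedge : ∀ a p, a ∈ t → p ∈ t → a ≠ u → p ≠ u →
        Homologous K (link (Δ ∪ t.powerset) {u}) a p := by
      intro a p ha hp hau hpu
      by_cases hap : a = p
      · rw [hap]; exact Homologous.refl _ _
      apply Homologous.of_edge hap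
      rw [mem_link hΓ.down]
      refine ⟨by simp [hau.symm, hpu.symm], mem_union_right _ ?_⟩
      simp [insert_subset_iff, ha, hp, hut]
    have hvert : ∀ a, {a} ∈ link (Δ ∪ t.powerset) {u} →
        a ≠ u ∧ (a ∈ t ∨ {a} ∈ link Δ {u}) := by
      intro a ha
      rw [singleton_mem_link hΓ.down] at ha
      refine ⟨ha.1, ?_⟩
      rw [singleton_mem_link h.down]
      rcases mem_union.1 ha.2 with h' | h'
      · exact Or.inr ⟨ha.1, h'⟩
      · exact Or.inl (mem_powerset.1 h' (by simp))
    rcases hadj u hut with hnew | ⟨p, hpt, hpu, hp⟩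
    · intro a b ha hb
      have hno : ∀ a, {a} ∉ link Δ {u} := by
        intro a ha
        rw [singleton_mem_link h.down] at ha
        exact hnew (h.down _ ha.2 _ (by simp))
      exact hedge a b ((hvert a ha).2.resolve_right (hno a)) ((hvert b hb).2.resolve_right (hno b))
        (hvert a ha).1 (hvert b hb).1
    · apply isHomConnected_of_base p
      intro a ha
      obtain ⟨hau, hat | ha⟩ := hvert a ha
      · exact hedge a p hat hpt hau hpu
      · exact (hlink u (h.down _ hp _ (by simp)) a p ha
          ((singleton_mem_link h.down).2 ⟨hpu, hp⟩)).mono hsub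
  · have heq : link (Δ ∪ t.powerset) {u} = link Δ {u} := by
      refine subset_antisymm (fun G hG => ?_) hsub
      rw [mem_link hΓ.down] at hG
      rw [mem_link h.down]
      refine ⟨hG.1, (mem_union.1 hG.2).resolve_right fun h' => hut (mem_powerset.1 h' (by simp))⟩
    rw [heq]
    exact hlink u ((mem_union.1 hu).resolve_right fun h' => hut (mem_powerset.1 h' (by simp)))

lemma isConnectedComplex_union_powerset (hc : IsConnectedComplex Δ) {p : ℕ} (hp : p ∈ t)
    (hpΔ : {p} ∈ Δ) : IsConnectedComplex (Δ ∪ t.powerset) := by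
  have : Std.Symm fun a b : ℕ => a ≠ b ∧ ({a, b} : Finset ℕ) ∈ Δ ∪ t.powerset :=
    ⟨fun a b hab => ⟨hab.1.symm, by rw [Finset.pair_comm]; exact hab.2⟩⟩
  have key : ∀ a : ℕ, {a} ∈ Δ ∪ t.powerset → Relation.ReflTransGen
      (fun a b : ℕ => a ≠ b ∧ ({a, b} : Finset ℕ) ∈ Δ ∪ t.powerset) a p := by
    intro a ha
    rcases mem_union.1 ha with ha | ha
    · exact Relation.ReflTransGen.mono (fun _ _ hab => ⟨hab.1, mem_union_left _ hab.2⟩) _ _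
        (hc a p ha hpΔ)
    · by_cases hap : a = p
      · rw [hap]
      · refine Relation.ReflTransGen.single ⟨hap, mem_union_right _ ?_⟩
        simp only [mem_powerset, singleton_subset_iff] at ha
        simp [insert_subset_iff, ha, hp]
  exact fun a b ha hb => (key a ha).trans (symm (key b hb))

end AddTriangle

section HVector

lemma hVector3_iff (Δ : Finset (Finset ℕ)) (b c e : ℤ) :
    hVector3 Δ 1 b c e ↔ ((facesOf Δ 1).card : ℤ) = b + 3 ∧
      ((facesOf Δ 2).card : ℤ) = c + 2 * b + 3 ∧ ((facesOf Δ 3).card : ℤ) = e + c + b + 1 := by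
  have h32 : Nat.choose 3 2 = 3 := rfl
  simp only [hVector3, hVec, fVec, Finset.sum_range_succ, Finset.sum_range_zero]
  norm_num [h32]
  constructor
  · rintro ⟨h1, h2, h3⟩
    refine ⟨?_, ?_, ?_⟩ <;> linarith
  · rintro ⟨h1, h2, h3⟩
    refine ⟨?_, ?_, ?_⟩ <;> linarith

/-- There is a `2`-dimensional connected Buchsbaum complex with `h`-vector `(1, b, c, e)`. -/
def IsBuchsbaumHVector (K : Type) [Field K] (b c e : ℤ) : Prop :=
  ∃ (n : ℕ) (Δ : Finset (Finset ℕ)), IsComplexOn n Δ ∧ dimZ Δ = 2 ∧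
    IsConnectedComplex Δ ∧ IsBuchsbaum K Δ ∧ hVector3 Δ 1 b c e

variable {K : Type} [Field K]

lemma exists_edge {Δ : Finset (Finset ℕ)} (h : IsPureComplex 3 Δ) :
    ∃ a b : ℕ, a ≠ b ∧ {a, b} ∈ Δ := by
  obtain ⟨F, hF⟩ := h.nonempty
  obtain ⟨G, hG, -, hc⟩ := h.exists_facet F hF
  obtain ⟨a, b, c, hab, -, -, rfl⟩ := card_eq_three.1 hc
  exact ⟨a, b, hab, h.down _ hG _ (by simp [insert_subset_iff])⟩

/-- Glue a triangle along an edge, adding one new vertex. -/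
lemma IsBuchsbaumHVector.add_vertex {b c e : ℤ} (h : IsBuchsbaumHVector K b c e) :
    IsBuchsbaumHVector K (b + 1) c e := by
  obtain ⟨n, Δ, hn, hd, hconn, hB, hvec⟩ := h
  have hΔ := isPureComplex_three hn.1 hd hB.1
  obtain ⟨p, q, hpq, hpqΔ⟩ := exists_edge hΔ
  have hp := hn.2.1 _ hpqΔ p (by simp)
  have hq := hn.2.1 _ hpqΔ q (by simp)
  have hnew : ∀ F ∈ Δ, n + 1 ∉ F := fun F hF hv => by simpa using hn.2.1 F hF _ hv
  have hpn : n + 1 ≠ p := fun h => hnew _ hpqΔ (by simp [h])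
  have hqn : n + 1 ≠ q := fun h => hnew _ hpqΔ (by simp [h])
  set t : Finset ℕ := {n + 1, p, q} with ht_def
  have ht : t.card = 3 := card_eq_three.2 ⟨_, _, _, hpn, hqn, hpq, rfl⟩
  have hΓ := hΔ.union_powerset ht
  rw [isBuchsbaum_iff hΔ] at hB
  have hpΔ : {p} ∈ Δ := hΔ.down _ hpqΔ _ (by simp)
  have hmem : ∀ F, F ∈ Δ ∪ t.powerset ↔ F ∈ Δ ∨ (n + 1 ∈ F ∧ F ⊆ t) := by
    intro F
    rw [mem_union, mem_powerset]
    refine ⟨fun h => ?_, fun h => h.imp id And.right⟩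
    rcases h with h | h
    · exact Or.inl h
    · by_cases hv : n + 1 ∈ F
      · exact Or.inr ⟨hv, h⟩
      · exact Or.inl (hΔ.down _ hpqΔ _ ((subset_insert_iff_of_notMem hv).1 h))
  refine ⟨n + 1, Δ ∪ t.powerset, ⟨hΓ.down, ?_, ?_⟩, ?_, ?_, ?_, ?_⟩
  · intro F hF i hi
    rcases mem_union.1 hF with hF | hF
    · have := hn.2.1 F hF i hi
      simp only [mem_Icc] at this ⊢
      omega
    · have := mem_powerset.1 hF hi
      simp only [ht_def, mem_insert, mem_singleton, mem_Icc] at this hp hq ⊢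
      omega
  · intro i hi
    by_cases hi' : i = n + 1
    · subst hi'
      exact mem_union_right _ (by simp [ht_def])
    · refine mem_union_left _ (hn.2.2 i ?_)
      simp only [mem_Icc] at hi ⊢
      omega
  · simp [dimZ, hΓ.sup_card]
  · exact isConnectedComplex_union_powerset (p := p) hconn (by simp [ht_def]) hpΔ
  · rw [isBuchsbaum_iff hΓ]
    refine isHomConnected_link_union_powerset hΔ ht hB ?_
    intro u hu
    simp only [ht_def, mem_insert, mem_singleton] at hu
    rcases hu with rfl | rfl | rfl
    · exact Or.inl fun h => hnew _ h (by simp)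
    · exact Or.inr ⟨q, by simp [ht_def], hpq.symm, by rwa [Finset.pair_comm]⟩
    · exact Or.inr ⟨p, by simp [ht_def], hpq, hpqΔ⟩
  · have hcard : ∀ m, (facesOf (Δ ∪ t.powerset) (m + 1)).card =
        (facesOf Δ (m + 1)).card + Nat.choose 2 m := by
      intro m
      have heq : facesOf (Δ ∪ t.powerset) (m + 1) = facesOf Δ (m + 1) ∪
          (powersetCard m {p, q}).image (insert (n + 1)) := by
        ext F
        simp only [facesOf, mem_filter, hmem, mem_union, mem_image, mem_powersetCard, or_and_right]
        refine or_congr_right ⟨?_, ?_⟩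
        · rintro ⟨⟨hv, hF⟩, hm⟩
          refine ⟨F.erase (n + 1), ⟨?_, ?_⟩, insert_erase hv⟩
          · exact subset_insert_iff.1 hF
          · rw [card_erase_of_mem hv, hm]; rfl
        · rintro ⟨G, ⟨hG, hm⟩, rfl⟩
          refine ⟨⟨by simp, insert_subset_insert _ hG⟩, ?_⟩
          rw [card_insert_of_notMem, hm]
          exact fun hv => by simpa [hpn, hqn] using hG hv
      rw [heq, card_union_of_disjoint, card_image_of_injOn, card_powersetCard, card_pair hpq]
      · have hv : ∀ G ∈ powersetCard m ({p, q} : Finset ℕ), n + 1 ∉ G := by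
          intro G hG hv
          simpa [hpn, hqn] using (mem_powersetCard.1 hG).1 hv
        intro G hG H hH hGH
        rw [← erase_insert (hv G hG), ← erase_insert (hv H hH)]
        exact congrArg (fun F => F.erase (n + 1)) hGH
      · rw [Finset.disjoint_left]
        intro F hF hF'
        obtain ⟨G, -, rfl⟩ := mem_image.1 hF'
        exact hnew _ (mem_filter.1 hF).1 (by simp)
    rw [hVector3_iff] at hvec ⊢
    have h1 := hcard 0
    have h2 := hcard 1
    have h3 := hcard 2
    norm_num at h1 h2 h3
    omega

lemma card_facesOf_one {n : ℕ} {Δ : Finset (Finset ℕ)} (h : IsComplexOn n Δ) :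
    (facesOf Δ 1).card = n := by
  have : facesOf Δ 1 = powersetCard 1 (Icc 1 n) := by
    ext F
    simp only [facesOf, mem_filter, mem_powersetCard]
    refine and_congr_left fun hF => ⟨fun hF' i hi => h.2.1 F hF' i hi, fun hF' => ?_⟩
    obtain ⟨a, rfl⟩ := card_eq_one.1 hF
    exact h.2.2 a (hF' (by simp))
  simp [this]

lemma card_facesOf_two_of_complete {n : ℕ} {Δ : Finset (Finset ℕ)} (h : IsComplexOn n Δ)
    (hc : ∀ a b : ℕ, a ≠ b → {a} ∈ Δ → {b} ∈ Δ → {a, b} ∈ Δ) :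
    (facesOf Δ 2).card = n.choose 2 := by
  have : facesOf Δ 2 = powersetCard 2 (Icc 1 n) := by
    ext F
    simp only [facesOf, mem_filter, mem_powersetCard]
    refine and_congr_left fun hF => ⟨fun hF' i hi => h.2.1 F hF' i hi, fun hF' => ?_⟩
    obtain ⟨a, b, hab, rfl⟩ := card_eq_two.1 hF
    exact hc a b hab (h.2.2 a (hF' (by simp))) (h.2.2 b (hF' (by simp)))
  simp [this]

lemma exists_induced_path {Δ : Finset (Finset ℕ)} (hconn : IsConnectedComplex Δ) {a b : ℕ}
    (hab : a ≠ b) (ha : {a} ∈ Δ) (hb : {b} ∈ Δ) (hnot : {a, b} ∉ Δ) :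
    ∃ p q r : ℕ, p ≠ q ∧ q ≠ r ∧ p ≠ r ∧ {p, q} ∈ Δ ∧ {q, r} ∈ Δ ∧ {p, r} ∉ Δ := by
  by_contra! hno
  have key : ∀ x, Relation.ReflTransGen (fun a b : ℕ => a ≠ b ∧ ({a, b} : Finset ℕ) ∈ Δ) a x →
      x = a ∨ {a, x} ∈ Δ := by
    intro x hx
    induction hx with
    | refl => exact Or.inl rfl
    | @tail y z _ hyz ih =>
      by_cases hza : z = a
      · exact Or.inl hza
      refine Or.inr ?_
      by_cases hya : y = a
      · rw [← hya]; exact hyz.2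
      · exact hno a y z (Ne.symm hya) hyz.1 (Ne.symm hza) (ih.resolve_left hya) hyz.2
  exact (key b (hconn a b ha hb)).elim (fun h => hab h.symm) hnot

/-- Fill in a missing edge together with a triangle containing it. -/
lemma IsBuchsbaumHVector.add_edge {b c : ℕ} {e : ℤ} (h : IsBuchsbaumHVector K b c e)
    (hlt : c < (b + 1).choose 2) : IsBuchsbaumHVector K b (c + 1 : ℕ) e := by
  obtain ⟨n, Δ, hn, hd, hconn, hB, hvec⟩ := h
  have hΔ := isPureComplex_three hn.1 hd hB.1
  obtain ⟨p, q, r, hpq, hqr, hpr, hpqΔ, hqrΔ, hprΔ⟩ : ∃ p q r : ℕ, p ≠ q ∧ q ≠ r ∧ p ≠ r ∧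
      {p, q} ∈ Δ ∧ {q, r} ∈ Δ ∧ {p, r} ∉ Δ := by
    by_contra hno
    have h1 := card_facesOf_one hn
    have h2 := card_facesOf_two_of_complete hn fun a b hab ha hb => by
      by_contra hnot
      exact hno (exists_induced_path hconn hab ha hb hnot)
    rw [hVector3_iff] at hvec
    obtain rfl : n = b + 3 := by omega
    have e1 : (b + 3).choose 2 = (b + 2) + (b + 2).choose 2 := by
      rw [Nat.choose_succ_succ' (b + 2) 1, Nat.choose_one_right]
    have e2 : (b + 2).choose 2 = (b + 1) + (b + 1).choose 2 := by
      rw [Nat.choose_succ_succ' (b + 1) 1, Nat.choose_one_right]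
    omega
  set t : Finset ℕ := {p, q, r} with ht_def
  have ht : t.card = 3 := card_eq_three.2 ⟨_, _, _, hpq, hpr, hqr, rfl⟩
  have hΓ := hΔ.union_powerset ht
  rw [isBuchsbaum_iff hΔ] at hB
  have htΔ : t ∉ Δ := fun h => hprΔ (hΔ.down _ h _ (by simp [ht_def, insert_subset_iff]))
  have hmem : ∀ F, F ∈ Δ ∪ t.powerset ↔ F ∈ Δ ∨ F = {p, r} ∨ F = t := by
    intro F
    rw [mem_union, mem_powerset]
    refine or_congr_right' fun hF => ⟨fun h => ?_, ?_⟩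
    · have hpF : p ∈ F := by
        by_contra hpF
        exact hF (hΔ.down _ hqrΔ _ ((subset_insert_iff_of_notMem hpF).1 h))
      have hrF : r ∈ F := by
        by_contra hrF
        refine hF (hΔ.down _ hpqΔ _ fun x hx => ?_)
        have := h hx
        simp only [ht_def, mem_insert, mem_singleton] at this ⊢
        rcases this with rfl | rfl | rfl
        · simp
        · simp
        · exact absurd hx hrF
      by_cases hqF : q ∈ F
      · right
        refine subset_antisymm h ?_
        simp [ht_def, insert_subset_iff, hpF, hqF, hrF]
      · left
        refine subset_antisymm (fun x hx => ?_) (by simp [insert_subset_iff, hpF, hrF])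
        have := h hx
        simp only [ht_def, mem_insert, mem_singleton] at this ⊢
        rcases this with rfl | rfl | rfl
        · simp
        · exact absurd hx hqF
        · simp
    · rintro (rfl | rfl)
      · simp [ht_def, insert_subset_iff]
      · exact Subset.rfl
  refine ⟨n, Δ ∪ t.powerset, ⟨hΓ.down, ?_, ?_⟩, ?_, ?_, ?_, ?_⟩
  · intro F hF i hi
    rcases mem_union.1 hF with hF | hF
    · exact hn.2.1 F hF i hi
    · have := mem_powerset.1 hF hi
      simp only [ht_def, mem_insert, mem_singleton] at this
      rcases this with rfl | rfl | rfl
      · exact hn.2.1 _ hpqΔ _ (by simp)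
      · exact hn.2.1 _ hpqΔ _ (by simp)
      · exact hn.2.1 _ hqrΔ _ (by simp)
  · exact fun i hi => mem_union_left _ (hn.2.2 i hi)
  · simp [dimZ, hΓ.sup_card]
  · exact isConnectedComplex_union_powerset (p := p) hconn (by simp [ht_def])
      (hΔ.down _ hpqΔ _ (by simp))
  · rw [isBuchsbaum_iff hΓ]
    refine isHomConnected_link_union_powerset hΔ ht hB ?_
    intro u hu
    simp only [ht_def, mem_insert, mem_singleton] at hu
    rcases hu with rfl | rfl | rfl
    · exact Or.inr ⟨q, by simp [ht_def], hpq.symm, by rwa [Finset.pair_comm]⟩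
    · exact Or.inr ⟨p, by simp [ht_def], hpq, hpqΔ⟩
    · exact Or.inr ⟨q, by simp [ht_def], hqr, hqrΔ⟩
  · have hc2 : ({p, r} : Finset ℕ).card = 2 := card_pair hpr
    have h1 : facesOf (Δ ∪ t.powerset) 1 = facesOf Δ 1 := by
      ext F
      simp only [facesOf, mem_filter, hmem]
      refine and_congr_left fun hF => or_iff_left ?_
      rintro (rfl | rfl) <;> omega
    have h2 : facesOf (Δ ∪ t.powerset) 2 = insert {p, r} (facesOf Δ 2) := by
      ext F
      simp only [facesOf, mem_filter, hmem, mem_insert]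
      constructor
      · rintro ⟨hF | rfl | rfl, hF'⟩
        · exact Or.inr ⟨hF, hF'⟩
        · exact Or.inl rfl
        · omega
      · rintro (rfl | hF)
        · exact ⟨Or.inr (Or.inl rfl), hc2⟩
        · exact ⟨Or.inl hF.1, hF.2⟩
    have h3 : facesOf (Δ ∪ t.powerset) 3 = insert t (facesOf Δ 3) := by
      ext F
      simp only [facesOf, mem_filter, hmem, mem_insert]
      constructor
      · rintro ⟨hF | rfl | rfl, hF'⟩
        · exact Or.inr ⟨hF, hF'⟩
        · omega
        · exact Or.inl rfl
      · rintro (rfl | hF)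
        · exact ⟨Or.inr (Or.inr rfl), ht⟩
        · exact ⟨Or.inl hF.1, hF.2⟩
    rw [hVector3_iff] at hvec ⊢
    rw [h1, h2, h3, card_insert_of_notMem, card_insert_of_notMem]
    · push_cast
      omega
    · exact fun h => htΔ (mem_filter.1 h).1
    · exact fun h => hprΔ (mem_filter.1 h).1

lemma IsBuchsbaumHVector.mono {a b c d : ℕ} {e : ℤ} (h : IsBuchsbaumHVector K a c e)
    (hab : a ≤ b) (hcd : c ≤ d) (hd : d ≤ (b + 1).choose 2) : IsBuchsbaumHVector K b d e := by
  have hb : IsBuchsbaumHVector K b c e := by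
    clear hd
    induction b, hab using Nat.le_induction with
    | base => exact h
    | succ b _ ih => exact_mod_cast ih.add_vertex
  induction d, hcd using Nat.le_induction with
  | base => exact hb
  | succ d _ ih => exact (ih (by omega)).add_edge (by omega)

end HVector

/-- **Lemma 3.1.** With `x` the least `k` with `3w ≤ C(k+1,2)` and
`y = min{h2, C(x+1,2)}`: if there is a `2`-dimensional connected Buchsbaum complex
with `h`-vector `(1,x,y,-w)`, then there is one with `h`-vector `(1,h1,h2,-w)`. -/
theorem stmt11 (K : Type) [Field K] (h1 h2 w x : ℕ)
    (hh1 : 0 < h1) (hh2 : 0 < h2) (hw : 0 < w)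
    (h3w : 3 * w ≤ h2) (hup : h2 ≤ (h1 + 1).choose 2)
    (hx1 : 3 * w ≤ (x + 1).choose 2) (hx2 : ∀ k < x, ¬ 3 * w ≤ (k + 1).choose 2)
    (hex : ∃ (n : ℕ) (Δ : Finset (Finset ℕ)), IsComplexOn n Δ ∧ dimZ Δ = 2 ∧
      IsConnectedComplex Δ ∧ IsBuchsbaum K Δ ∧
      hVector3 Δ 1 (x : ℤ) ((min h2 ((x + 1).choose 2) : ℕ) : ℤ) (-(w : ℤ))) :
    ∃ (n : ℕ) (Γ : Finset (Finset ℕ)), IsComplexOn n Γ ∧ dimZ Γ = 2 ∧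
      IsConnectedComplex Γ ∧ IsBuchsbaum K Γ ∧
      hVector3 Γ 1 (h1 : ℤ) (h2 : ℤ) (-(w : ℤ)) := by
  have hxh : x ≤ h1 := by
    by_contra! hlt
    exact hx2 h1 hlt (h3w.trans hup)
  exact IsBuchsbaumHVector.mono hex hxh (min_le_left _ _) hup
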